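/- The limit as s → 0⁺ of [∫₀^π (h₁(q,s) + i·h₂(q,s)) dq − ln(16/s) − i·π/2] equals 0 (limit in ℂ). -/

import Mathlib

open Real Filter Topology Complex

/-- The integrand is the conjugate branch `(sin² q - i s)^(-1/2)`, written through its real and
imaginary parts. -/
lemma sqrt_add_sqrt_mul_I_eq_inv_cpow (a : ℝ) {s : ℝ} (hs : 0 < s) :
    ((√((√(a ^ 2 + s ^ 2) + a) / (2 * (a ^ 2 + s ^ 2))) : ℝ) : ℂ) +
      ((√((√(a ^ 2 + s ^ 2) - a) / (2 * (a ^ 2 + s ^ 2))) : ℝ) : ℂ) * I =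
      (((a : ℂ) - s * I) ^ (2⁻¹ : ℂ))⁻¹ := by
  set z : ℂ := (a : ℂ) - s * I with hz
  have hre : z.re = a := by simp [hz]
  have him : z.im = -s := by simp [hz]
  have hnorm : normSq z = a ^ 2 + s ^ 2 := by rw [normSq_apply, hre, him]; ring
  have hpos : 0 < a ^ 2 + s ^ 2 := by positivity
  have harg : z.arg ≠ π := by
    intro h
    have := (arg_eq_pi_iff.1 h).2
    linarith
  have hn : ‖z⁻¹‖ = √(a ^ 2 + s ^ 2) / (a ^ 2 + s ^ 2) := by
    rw [norm_inv, Complex.norm_def, hnorm, Real.sqrt_div_self', one_div]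
  have hire : (z⁻¹).re = a / (a ^ 2 + s ^ 2) := by rw [inv_re, hre, hnorm]
  have hiim : 0 ≤ (z⁻¹).im := by
    rw [inv_im, him, hnorm, neg_neg]
    positivity
  rw [← inv_cpow _ _ harg]
  apply Complex.ext
  · rw [cpow_inv_two_re, hn, hire]
    simp only [add_re, ofReal_re, mul_re, I_re, mul_zero, ofReal_im, I_im, mul_one, sub_self,
      add_zero]
    congr 1
    field_simp
  · rw [cpow_inv_two_im_eq_sqrt hiim, hn, hire]
    simp only [add_im, ofReal_re, mul_im, I_re, mul_zero, ofReal_im, I_im, mul_one,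
      add_zero, zero_add]
    congr 1
    field_simp

lemma sq_sub_mul_I_mem_slitPlane (x : ℝ) {s : ℝ} (hs : 0 < s) :
    (x : ℂ) ^ 2 - s * I ∈ slitPlane := by
  refine Or.inr ?_
  rw [← ofReal_pow, sub_im, ofReal_im]
  simp [hs.ne']

lemma cpow_inv_two_re_pos {z : ℂ} (hz : z ∈ slitPlane) : 0 < (z ^ (2⁻¹ : ℂ)).re := by
  rw [cpow_inv_two_re, Real.sqrt_pos]
  rcases hz with h | h
  · have := norm_nonneg z
    linarith
  · have := (abs_re_lt_norm (z := z)).2 h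
    have := neg_abs_le z.re
    linarith

/-- `log (u + √(u² - i s))` is a primitive of `1 / √(u² - i s)`. -/
lemma hasDerivAt_log_add_cpow {x s : ℝ} (hx : 0 ≤ x) (hs : 0 < s) :
    HasDerivAt (fun u : ℂ => log (u + (u ^ 2 - s * I) ^ (2⁻¹ : ℂ)))
      (((x : ℂ) ^ 2 - s * I) ^ (2⁻¹ : ℂ))⁻¹ x := by
  have hz := sq_sub_mul_I_mem_slitPlane x hs
  have hw := cpow_inv_two_re_pos hz
  have hsq : (((x : ℂ) ^ 2 - s * I) ^ (2⁻¹ : ℂ)) ^ 2 = (x : ℂ) ^ 2 - s * I := by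
    simp
  have hmem : (x : ℂ) + ((x : ℂ) ^ 2 - s * I) ^ (2⁻¹ : ℂ) ∈ slitPlane :=
    Or.inl (by rw [add_re, ofReal_re]; linarith)
  have hpow : HasDerivAt (fun u : ℂ => u ^ 2 - s * I) (2 * x) (x : ℂ) := by
    simpa using (hasDerivAt_pow 2 (x : ℂ)).sub_const (s * I)
  have h := ((hasDerivAt_id (x : ℂ)).add (hpow.cpow_const (c := 2⁻¹) hz)).clog hmem
  refine h.congr_deriv ?_
  have hexp : ((x : ℂ) ^ 2 - s * I) ^ ((2⁻¹ : ℂ) - 1) =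
      (((x : ℂ) ^ 2 - s * I) ^ (2⁻¹ : ℂ))⁻¹ := by
    rw [← cpow_neg]
    norm_num
  have hsum := slitPlane_ne_zero hmem
  simp only [hexp, Pi.add_apply, id]
  generalize ((x : ℂ) ^ 2 - s * I) ^ (2⁻¹ : ℂ) = w at *
  have hw0 : w ≠ 0 := by
    rintro rfl
    simp at hw
  field_simp
  ring

lemma continuous_inv_cpow_sin {s : ℝ} (hs : 0 < s) :
    Continuous fun q : ℝ => ((((Real.sin q : ℝ) : ℂ) ^ 2 - s * I) ^ (2⁻¹ : ℂ))⁻¹ := by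
  refine Continuous.inv₀ (Continuous.cpow (by fun_prop) continuous_const
    fun q => sq_sub_mul_I_mem_slitPlane _ hs) fun q h => ?_
  have := cpow_inv_two_re_pos (sq_sub_mul_I_mem_slitPlane (Real.sin q) hs)
  rw [h] at this
  simp at this

lemma integral_cos_mul_inv_cpow_sin {s : ℝ} (hs : 0 < s) :
    ∫ q in (0 : ℝ)..π / 2, ((Real.cos q : ℝ) : ℂ) *
        ((((Real.sin q : ℝ) : ℂ) ^ 2 - s * I) ^ (2⁻¹ : ℂ))⁻¹ =
      log (1 + (1 - s * I) ^ (2⁻¹ : ℂ)) - log ((-(s * I)) ^ (2⁻¹ : ℂ)) := by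
  have hderiv : ∀ q ∈ Set.uIcc 0 (π / 2), HasDerivAt
      (fun q : ℝ => log (((Real.sin q : ℝ) : ℂ) +
        (((Real.sin q : ℝ) : ℂ) ^ 2 - s * I) ^ (2⁻¹ : ℂ)))
      (((Real.cos q : ℝ) : ℂ) *
        ((((Real.sin q : ℝ) : ℂ) ^ 2 - s * I) ^ (2⁻¹ : ℂ))⁻¹) q := by
    intro q hq
    rw [Set.uIcc_of_le (by positivity)] at hq
    have hsin : 0 ≤ Real.sin q :=
      Real.sin_nonneg_of_nonneg_of_le_pi hq.1 (by linarith [hq.2, Real.pi_pos])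
    have := (hasDerivAt_log_add_cpow hsin hs).comp q (Real.hasDerivAt_sin q).ofReal_comp
    rw [mul_comm ((Real.cos q : ℝ) : ℂ)]
    exact this
  rw [intervalIntegral.integral_eq_sub_of_hasDerivAt hderiv
    ((Continuous.mul (by fun_prop) (continuous_inv_cpow_sin hs)).intervalIntegrable _ _)]
  simp

lemma log_cpow_inv_two_neg_mul_I {s : ℝ} (hs : 0 < s) :
    log ((-(s * I)) ^ (2⁻¹ : ℂ)) = (Real.log s - π / 2 * I) / 2 := by
  have hlog : log (-(s * I)) = Real.log s - π / 2 * I := by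
    rw [← mul_neg, log_ofReal_mul hs (neg_ne_zero.2 I_ne_zero), log_neg_I]
    ring
  have hne : -((s : ℂ) * I) ≠ 0 := by simp [hs.ne']
  have him : ((Real.log s - π / 2 * I : ℂ) * 2⁻¹).im = -(π / 4) := by
    have : (Real.log s - π / 2 * I : ℂ) * 2⁻¹ =
        ((Real.log s / 2 : ℝ) : ℂ) + ((-(π / 4) : ℝ) : ℂ) * I := by
      push_cast
      ring
    rw [this]
    simp
  rw [cpow_def_of_ne_zero hne, hlog, Complex.log_exp]
  · rw [div_eq_mul_inv (_ - _)]
  · rw [him]; linarith [Real.pi_pos]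
  · rw [him]; linarith [Real.pi_pos]

lemma integral_sin_div_one_add_cos :
    ∫ q in (0 : ℝ)..π / 2, Real.sin q / (1 + Real.cos q) = Real.log 2 := by
  have hpos : ∀ q ∈ Set.uIcc 0 (π / 2), 0 < 1 + Real.cos q := by
    intro q hq
    rw [Set.uIcc_of_le (by positivity)] at hq
    have := Real.cos_nonneg_of_neg_pi_div_two_le_of_le
      (by linarith [hq.1, Real.pi_pos] : -(π / 2) ≤ q) hq.2
    linarith
  have hderiv : ∀ q ∈ Set.uIcc 0 (π / 2),
      HasDerivAt (fun q => -Real.log (1 + Real.cos q)) (Real.sin q / (1 + Real.cos q)) q := by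
    intro q hq
    refine (((Real.hasDerivAt_cos q).const_add 1).log (hpos q hq).ne').neg.congr_deriv ?_
    ring
  have hcont : ContinuousOn (fun q => Real.sin q / (1 + Real.cos q)) (Set.uIcc 0 (π / 2)) :=
    ContinuousOn.div (by fun_prop) (by fun_prop) fun q hq => (hpos q hq).ne'
  rw [intervalIntegral.integral_eq_sub_of_hasDerivAt hderiv hcont.intervalIntegrable]
  norm_num

lemma norm_inv_cpow_inv_two_le {x : ℝ} (hx : 0 < x) (s : ℝ) :
    ‖(((x : ℂ) ^ 2 - s * I) ^ (2⁻¹ : ℂ))⁻¹‖ ≤ x⁻¹ := by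
  rw [norm_inv]
  refine inv_anti₀ hx (abs_le_of_sq_le_sq' ?_ (norm_nonneg _)).2
  have hsq : (((x : ℂ) ^ 2 - s * I) ^ (2⁻¹ : ℂ)) ^ 2 = (x : ℂ) ^ 2 - s * I := by
    simp
  rw [← norm_pow, hsq]
  refine le_trans (le_of_eq ?_) (re_le_norm _)
  rw [← ofReal_pow, sub_re, ofReal_re]
  simp

lemma tendsto_inv_cpow_inv_two {x : ℝ} (hx : 0 < x) :
    Tendsto (fun s : ℝ => (((x : ℂ) ^ 2 - s * I) ^ (2⁻¹ : ℂ))⁻¹) (𝓝 0) (𝓝 (x : ℂ)⁻¹) := by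
  have hmem : (x : ℂ) ^ 2 - ((0 : ℝ) : ℂ) * I ∈ slitPlane := by
    refine Or.inl ?_
    rw [ofReal_zero, zero_mul, sub_zero, ← ofReal_pow, ofReal_re]
    exact pow_pos hx 2
  have hval : ((x : ℂ) ^ 2 - ((0 : ℝ) : ℂ) * I) ^ (2⁻¹ : ℂ) = x := by
    rw [ofReal_zero, zero_mul, sub_zero]
    have := pow_cpow_nat_inv (x := (x : ℂ)) (n := 2) two_ne_zero
      (by rw [arg_ofReal_of_nonneg hx.le]; simp [Real.pi_pos])
      (by rw [arg_ofReal_of_nonneg hx.le]; positivity)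
    simpa using this
  have hcont : ContinuousAt (fun s : ℝ => ((x : ℂ) ^ 2 - s * I) ^ (2⁻¹ : ℂ)) 0 :=
    ContinuousAt.cpow (by fun_prop) continuousAt_const hmem
  have h := hcont.tendsto
  rw [hval] at h
  exact h.inv₀ (ofReal_ne_zero.2 hx.ne')

lemma tendsto_integral_one_sub_cos_mul_inv_cpow_sin :
    Tendsto (fun s : ℝ => ∫ q in (0 : ℝ)..π / 2, (((1 - Real.cos q : ℝ)) : ℂ) *
        ((((Real.sin q : ℝ) : ℂ) ^ 2 - s * I) ^ (2⁻¹ : ℂ))⁻¹)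
      (𝓝[>] 0) (𝓝 ((Real.log 2 : ℝ) : ℂ)) := by
  have hrange : ∀ q ∈ Set.uIoc 0 (π / 2), 0 < Real.sin q ∧ 0 ≤ Real.cos q := by
    intro q hq
    rw [Set.uIoc_of_le (by positivity)] at hq
    exact ⟨Real.sin_pos_of_pos_of_lt_pi hq.1 (by linarith [hq.2, Real.pi_pos]),
      Real.cos_nonneg_of_neg_pi_div_two_le_of_le (by linarith [hq.1, Real.pi_pos]) hq.2⟩
  have hhalf : ∀ q ∈ Set.uIoc 0 (π / 2),
      (1 - Real.cos q) * (Real.sin q)⁻¹ = Real.sin q / (1 + Real.cos q) := by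
    intro q hq
    obtain ⟨h1, h2⟩ := hrange q hq
    have h3 : 1 + Real.cos q ≠ 0 := by linarith
    field_simp
    linarith [Real.sin_sq_add_cos_sq q]
  rw [← integral_sin_div_one_add_cos, ← intervalIntegral.integral_ofReal]
  refine intervalIntegral.tendsto_integral_filter_of_dominated_convergence (fun _ => 1) ?_ ?_
    intervalIntegrable_const ?_
  · filter_upwards [self_mem_nhdsWithin] with s hs
    exact (Continuous.mul (by fun_prop) (continuous_inv_cpow_sin hs)).aestronglyMeasurable
  · refine Eventually.of_forall fun s => Eventually.of_forall fun q hq => ?_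
    obtain ⟨h1, h2⟩ := hrange q hq
    have hc : 0 ≤ 1 - Real.cos q := sub_nonneg.2 (Real.cos_le_one q)
    calc _ ≤ (1 - Real.cos q) * (Real.sin q)⁻¹ := by
          rw [norm_mul, norm_real, Real.norm_of_nonneg hc]
          exact mul_le_mul_of_nonneg_left (norm_inv_cpow_inv_two_le h1 s) hc
      _ = Real.sin q / (1 + Real.cos q) := hhalf q hq
      _ ≤ 1 := by
          rw [div_le_one (by linarith)]
          linarith [Real.sin_le_one q]
  · refine Eventually.of_forall fun q hq => ?_
    rw [← hhalf q hq, ofReal_mul, ofReal_inv]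
    exact ((tendsto_inv_cpow_inv_two (hrange q hq).1).mono_left nhdsWithin_le_nhds).const_mul _

lemma integral_zero_pi_eq_two_mul {f : ℝ → ℂ} (hf : Continuous f)
    (hsymm : ∀ q, f (π - q) = f q) :
    ∫ q in (0 : ℝ)..π, f q = 2 * ∫ q in (0 : ℝ)..π / 2, f q := by
  have h := intervalIntegral.integral_comp_sub_left (a := 0) (b := π / 2) f π
  simp only [hsymm, sub_zero, sub_half] at h
  rw [← intervalIntegral.integral_add_adjacent_intervals (hf.intervalIntegrable 0 (π / 2))
    (hf.intervalIntegrable (π / 2) π), ← h, two_mul]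

lemma integral_inv_cpow_sin {s : ℝ} (hs : 0 < s) :
    ∫ q in (0 : ℝ)..π, ((((Real.sin q : ℝ) : ℂ) ^ 2 - s * I) ^ (2⁻¹ : ℂ))⁻¹ =
      2 * (∫ q in (0 : ℝ)..π / 2, (((1 - Real.cos q : ℝ)) : ℂ) *
        ((((Real.sin q : ℝ) : ℂ) ^ 2 - s * I) ^ (2⁻¹ : ℂ))⁻¹) +
      2 * log (1 + (1 - s * I) ^ (2⁻¹ : ℂ)) - (Real.log s - π / 2 * I) := by
  have hc := continuous_inv_cpow_sin hs
  rw [integral_zero_pi_eq_two_mul hc fun q => by rw [Real.sin_pi_sub]]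
  have hsplit : ∫ q in (0 : ℝ)..π / 2, ((((Real.sin q : ℝ) : ℂ) ^ 2 - s * I) ^ (2⁻¹ : ℂ))⁻¹ =
      (∫ q in (0 : ℝ)..π / 2, ((1 - Real.cos q : ℝ) : ℂ) *
        ((((Real.sin q : ℝ) : ℂ) ^ 2 - s * I) ^ (2⁻¹ : ℂ))⁻¹) +
      ∫ q in (0 : ℝ)..π / 2, ((Real.cos q : ℝ) : ℂ) *
        ((((Real.sin q : ℝ) : ℂ) ^ 2 - s * I) ^ (2⁻¹ : ℂ))⁻¹ := by
    rw [← intervalIntegral.integral_add]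
    · simp only [← add_mul, ← ofReal_add, sub_add_cancel, ofReal_one, one_mul]
    all_goals exact (Continuous.mul (by fun_prop) hc).intervalIntegrable _ _
  rw [hsplit, integral_cos_mul_inv_cpow_sin hs, log_cpow_inv_two_neg_mul_I hs]
  ring

lemma tendsto_log_one_add_cpow :
    Tendsto (fun s : ℝ => log (1 + (1 - s * I) ^ (2⁻¹ : ℂ))) (𝓝 0)
      (𝓝 ((Real.log 2 : ℝ) : ℂ)) := by
  have hcont : ContinuousAt (fun s : ℝ => log (1 + (1 - s * I) ^ (2⁻¹ : ℂ))) 0 := by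
    refine ContinuousAt.clog (continuousAt_const.add
      (ContinuousAt.cpow (by fun_prop) continuousAt_const ?_)) ?_
    · simp
    · refine Or.inl ?_
      norm_num
  have h := hcont.tendsto
  have hval : log (1 + (1 - ((0 : ℝ) : ℂ) * I) ^ (2⁻¹ : ℂ)) = ((Real.log 2 : ℝ) : ℂ) := by
    rw [ofReal_log zero_le_two]
    norm_num
  rwa [hval] at h

theorem main_complex_asymptotics :
    Filter.Tendsto
      (fun s : ℝ =>
        (∫ q in (0:ℝ)..Real.pi,
          ((Real.sqrt ((Real.sqrt (Real.sin q ^ 4 + s ^ 2) + Real.sin q ^ 2) /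
              (2 * (Real.sin q ^ 4 + s ^ 2))) : ℂ) +
            (Real.sqrt ((Real.sqrt (Real.sin q ^ 4 + s ^ 2) - Real.sin q ^ 2) /
              (2 * (Real.sin q ^ 4 + s ^ 2))) : ℂ) * Complex.I)) -
          (Real.log (16 / s) : ℂ) - Complex.I * (Real.pi / 2 : ℂ))
      (nhdsWithin 0 (Set.Ioi 0)) (nhds 0) := by
  have hlim := ((tendsto_integral_one_sub_cos_mul_inv_cpow_sin.const_mul 2).add
    ((tendsto_log_one_add_cpow.mono_left nhdsWithin_le_nhds).const_mul 2)).sub_const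
    ((Real.log 16 : ℝ) : ℂ)
  have hlog : Real.log 16 = 4 * Real.log 2 := by
    rw [show (16 : ℝ) = 2 ^ 4 by norm_num, Real.log_pow]
    norm_num
  have hzero : 2 * ((Real.log 2 : ℝ) : ℂ) + 2 * ((Real.log 2 : ℝ) : ℂ) -
      ((Real.log 16 : ℝ) : ℂ) = 0 := by
    rw [hlog]
    push_cast
    ring
  rw [hzero] at hlim
  refine hlim.congr' ?_
  filter_upwards [self_mem_nhdsWithin] with s hs
  have hs : 0 < s := hs
  have hpow (q : ℝ) : Real.sin q ^ 4 = (Real.sin q ^ 2) ^ 2 := by ring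
  simp only [hpow, sqrt_add_sqrt_mul_I_eq_inv_cpow _ hs, ofReal_pow]
  rw [integral_inv_cpow_sin hs, Real.log_div (by norm_num) hs.ne']
  push_cast
  ring
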